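/- Let w ∈ (0,1/2), let M_w be the 3×3 real matrix [[1,0,2w],[0,2w,0],[2w,0,2w]], and let V be the 3×3 real matrix [[1,0,1/3],[0,1/3,0],[1/3,0,1/5]]. Then for any sequences (aₖ), (bₖ), (cₖ) of positive reals with aₖ → ∞, bₖ → ∞ and cₖ → 0, one has tr( (M_w + diag(aₖ,bₖ,cₖ))⁻¹ V ) → 1/(10w). -/

import Mathlib

open Filter Topology

/-- The trace of `M⁻¹ V` for a symmetric `3 × 3` matrix `M` whose middle coordinate decouples. -/
theorem trace_inv_mul_of_decoupled {A B C s : ℝ} (hA : A ≠ 0) (hB : B ≠ 0)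
    (hD : C - s ^ 2 * A⁻¹ ≠ 0) :
    ((!![A, 0, s; 0, B, 0; s, 0, C] : Matrix (Fin 3) (Fin 3) ℝ)⁻¹ *
      !![1, 0, 1/3; 0, 1/3, 0; 1/3, 0, 1/5]).trace =
    (A⁻¹ * C - 2 / 3 * s * A⁻¹ + 1 / 5) / (C - s ^ 2 * A⁻¹) + 1 / 3 * B⁻¹ := by
  have hD' : A * C - s ^ 2 ≠ 0 := by
    intro h
    apply hD
    field_simp
    linarith
  have hinv : (!![A, 0, s; 0, B, 0; s, 0, C] : Matrix (Fin 3) (Fin 3) ℝ)⁻¹ =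
      !![C / (A * C - s ^ 2), 0, -s / (A * C - s ^ 2); 0, B⁻¹, 0;
        -s / (A * C - s ^ 2), 0, A / (A * C - s ^ 2)] := by
    apply Matrix.inv_eq_right_inv
    ext i j
    fin_cases i <;> fin_cases j <;>
      simp [Matrix.mul_apply, Fin.sum_univ_three, hB] <;> field_simp <;> ring
  have hfac : C - s ^ 2 * A⁻¹ = (A * C - s ^ 2) / A := by field_simp
  rw [hinv, hfac]
  simp [Matrix.trace, Fin.sum_univ_three]
  field_simp
  ring


/-- Quadratic regression, Case 1 limit: a,b → ∞, c → 0 gives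
tr((M_w + diag(a,b,c))⁻¹ V) → 1/(10w). -/
theorem stmt_5 (w : ℝ) (hw : w ∈ Set.Ioo (0:ℝ) (1/2))
    (a b c : ℕ → ℝ) (ha0 : ∀ k, 0 < a k) (hb0 : ∀ k, 0 < b k) (hc0 : ∀ k, 0 < c k)
    (ha : Filter.Tendsto a Filter.atTop Filter.atTop)
    (hb : Filter.Tendsto b Filter.atTop Filter.atTop)
    (hc : Filter.Tendsto c Filter.atTop (nhds 0)) :
    Filter.Tendsto
      (fun k =>
        ((((!![1, 0, 2*w; 0, 2*w, 0; 2*w, 0, 2*w] : Matrix (Fin 3) (Fin 3) ℝ) +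
            Matrix.diagonal ![a k, b k, c k])⁻¹) *
          (!![1, 0, 1/3; 0, 1/3, 0; 1/3, 0, 1/5] : Matrix (Fin 3) (Fin 3) ℝ)).trace)
      Filter.atTop (nhds (1 / (10*w))) := by
  obtain ⟨hw0, hw1⟩ := hw
  have hu : Tendsto (fun k => (1 + a k)⁻¹) atTop (𝓝 0) :=
    (tendsto_atTop_add_const_left _ 1 ha).inv_tendsto_atTop
  have hv : Tendsto (fun k => (2 * w + b k)⁻¹) atTop (𝓝 0) :=
    (tendsto_atTop_add_const_left _ (2 * w) hb).inv_tendsto_atTop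
  have hC : Tendsto (fun k => 2 * w + c k) atTop (𝓝 (2 * w + 0)) := hc.const_add _
  have hden := hC.sub (hu.const_mul ((2 * w) ^ 2))
  have hnum := ((hu.mul hC).sub (hu.const_mul (2 / 3 * (2 * w)))).add_const (1 / 5)
  have hlim := (hnum.div hden (by simp [hw0.ne'])).add (hv.const_mul (1 / 3))
  have hval : (0 * (2 * w + 0) - 2 / 3 * (2 * w) * 0 + 1 / 5) / (2 * w + 0 - (2 * w) ^ 2 * 0) +
      1 / 3 * 0 = 1 / (10 * w) := by
    field_simp
    norm_num
    ring
  rw [hval] at hlim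
  refine hlim.congr fun k => ?_
  have hak := ha0 k
  have hbk := hb0 k
  have hck := hc0 k
  have hdet : 2 * w + c k - (2 * w) ^ 2 * (1 + a k)⁻¹ ≠ 0 := by
    have hle : (1 + a k)⁻¹ ≤ 1 := inv_le_one_of_one_le₀ (by linarith)
    have := mul_le_mul_of_nonneg_left hle (sq_nonneg (2 * w))
    apply ne_of_gt
    nlinarith
  have hM : (!![1, 0, 2*w; 0, 2*w, 0; 2*w, 0, 2*w] : Matrix (Fin 3) (Fin 3) ℝ) +
      Matrix.diagonal ![a k, b k, c k] =
      !![1 + a k, 0, 2*w; 0, 2*w + b k, 0; 2*w, 0, 2*w + c k] := by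
    ext i j
    fin_cases i <;> fin_cases j <;> simp
  rw [hM, trace_inv_mul_of_decoupled (by positivity) (by positivity) hdet]
  rfl
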